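/- arXiv:2110.12014 — 2 statements merged into one kernel-verified Lean document; each statement's English description precedes it below -/
import Mathlib

section
/- Let b > 0, L_f ≥ 0, L_ρ > 0, and Δ ≥ 0. Let f_cl : ℝⁿ → ℝⁿ be Lipschitz continuous with constant L_f, and let ρ : ([0,b] → ℝⁿ) → ℝ be a functional satisfying |ρ(s) − ρ(z)| ≤ L_ρ · sup_{t ∈ [0,b]} ‖s(t) − z(t)‖ for all continuous s, z : [0,b] → ℝⁿ. Let d ∈ ℝⁿ with ‖d‖ ≤ Δ/(L_ρ·b·e^{L_f·b}), and let φ, φᵈ : [0,b] → ℝⁿ be differentiable curves with φ′(t) = f_cl(φ(t)) and (φᵈ)′(t) = f_cl(φᵈ(t)) + d for all t ∈ [0,b] and φ(0) = φᵈ(0). If ρ(φ) ≥ Δ, then ρ(φᵈ) ≥ 0. -/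
/-- The Grönwall bound with zero initial value grows at most like `ε * x * exp (K * x)`. -/
theorem gronwallBound_zero_le {K ε x : ℝ} (hK : 0 ≤ K) (hε : 0 ≤ ε) :
    gronwallBound 0 K ε x ≤ ε * x * Real.exp (K * x) := by
  rcases hK.eq_or_lt with rfl | hK
  · simp [gronwallBound_K0]
  · rw [gronwallBound_of_K_ne_0 hK.ne']
    have h : Real.exp (K * x) - 1 ≤ K * x * Real.exp (K * x) := by
      have h1 := mul_le_mul_of_nonneg_right (Real.add_one_le_exp (-(K * x)))
        (Real.exp_pos (K * x)).le
      rw [← Real.exp_add, neg_add_cancel, Real.exp_zero] at h1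
      linarith
    calc 0 * Real.exp (K * x) + ε / K * (Real.exp (K * x) - 1)
        ≤ 0 * Real.exp (K * x) + ε / K * (K * x * Real.exp (K * x)) := by gcongr
      _ = ε * x * Real.exp (K * x) := by field_simp; ring

/-- paper's Theorem 3: if the nominal robustness satisfies `ρ φ ≥ Δ`
and `‖d‖ ≤ Δ / (L_ρ b e^{L_f b})`, then the perturbed robustness `ρ φᵈ` stays ≥ 0. -/
theorem robustness_preserved_under_disturbance
    {n : ℕ} (b L_f L_ρ Δ : ℝ) (hb : 0 < b) (hLf : 0 ≤ L_f) (hLρ : 0 < L_ρ)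
    (hΔ : 0 ≤ Δ)
    (f_cl : EuclideanSpace ℝ (Fin n) → EuclideanSpace ℝ (Fin n))
    (hf_lip : ∀ x y : EuclideanSpace ℝ (Fin n), ‖f_cl x - f_cl y‖ ≤ L_f * ‖x - y‖)
    (ρ : (ℝ → EuclideanSpace ℝ (Fin n)) → ℝ)
    (hρ_lip : ∀ s z : ℝ → EuclideanSpace ℝ (Fin n),
      ContinuousOn s (Set.Icc (0 : ℝ) b) → ContinuousOn z (Set.Icc (0 : ℝ) b) →
      |ρ s - ρ z| ≤ L_ρ * sSup ((fun t => ‖s t - z t‖) '' Set.Icc (0 : ℝ) b))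
    (d : EuclideanSpace ℝ (Fin n))
    (hd : ‖d‖ ≤ Δ / (L_ρ * b * Real.exp (L_f * b)))
    (φ φd : ℝ → EuclideanSpace ℝ (Fin n))
    (hφ : ∀ t ∈ Set.Icc (0 : ℝ) b, HasDerivAt φ (f_cl (φ t)) t)
    (hφd : ∀ t ∈ Set.Icc (0 : ℝ) b, HasDerivAt φd (f_cl (φd t) + d) t)
    (h0 : φ 0 = φd 0)
    (hρφ : ρ φ ≥ Δ) :
    ρ φd ≥ 0 := by
  have cφ : ContinuousOn φ (Set.Icc 0 b) := fun t ht => (hφ t ht).continuousAt.continuousWithinAt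
  have cφd : ContinuousOn φd (Set.Icc 0 b) :=
    fun t ht => (hφd t ht).continuousAt.continuousWithinAt
  have hdist : ∀ t ∈ Set.Icc (0 : ℝ) b, ‖φd t - φ t‖ ≤ ‖d‖ * b * Real.exp (L_f * b) := by
    intro t ht
    have hg := norm_le_gronwallBound_of_norm_deriv_right_le (f := fun t => φd t - φ t)
      (f' := fun t => f_cl (φd t) + d - f_cl (φ t)) (δ := 0) (K := L_f) (ε := ‖d‖)
      (cφd.sub cφ)
      (fun x hx => ((hφd x (Set.Ico_subset_Icc_self hx)).sub
        (hφ x (Set.Ico_subset_Icc_self hx))).hasDerivWithinAt)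
      (by simp [h0])
      (fun x _ => by
        rw [add_sub_right_comm]
        exact (norm_add_le _ _).trans (by gcongr; exact hf_lip _ _)) t ht
    rw [sub_zero] at hg
    calc ‖φd t - φ t‖ ≤ ‖d‖ * t * Real.exp (L_f * t) :=
          hg.trans (gronwallBound_zero_le hLf (norm_nonneg d))
      _ ≤ ‖d‖ * b * Real.exp (L_f * b) := by
          have := ht.2
          gcongr
  have hsup : sSup ((fun t => ‖φd t - φ t‖) '' Set.Icc (0 : ℝ) b)
      ≤ ‖d‖ * b * Real.exp (L_f * b) :=
    csSup_le ((Set.nonempty_Icc.2 hb.le).image _) (Set.forall_mem_image.2 hdist)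
  have hΔd : L_ρ * (‖d‖ * b * Real.exp (L_f * b)) ≤ Δ := by
    rw [le_div_iff₀ (by positivity)] at hd
    linarith
  have hρ := (hρ_lip φd φ cφd cφ).trans ((mul_le_mul_of_nonneg_left hsup hLρ.le).trans hΔd)
  have := (abs_le.1 hρ).1
  linarith
end

section
/- Let b > 0, L_f ≥ 0, L_ρ ≥ 0, and M ≥ 0. Let f_cl : ℝⁿ → ℝⁿ be Lipschitz continuous with constant L_f, and let ρ : ([0,b] → ℝⁿ) → ℝ be a functional satisfying |ρ(s) − ρ(z)| ≤ L_ρ · sup_{t ∈ [0,b]} ‖s(t) − z(t)‖ for all continuous s, z : [0,b] → ℝⁿ. Let d ∈ ℝⁿ with ‖d‖ ≤ M, and let φ, φᵈ : [0,b] → ℝⁿ be differentiable curves with φ′(t) = f_cl(φ(t)) and (φᵈ)′(t) = f_cl(φᵈ(t)) + d for all t ∈ [0,b] and φ(0) = φᵈ(0). Then |ρ(φ) − ρ(φᵈ)| ≤ L_ρ·M·b·e^{L_f·b}. -/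
/-- With zero initial value, the Grönwall bound is at most `ε * x * exp (K * x)`. -/
theorem gronwallBound_zero_le_mul_exp {K ε : ℝ} (hK : 0 ≤ K) (hε : 0 ≤ ε) (x : ℝ) :
    gronwallBound 0 K ε x ≤ ε * x * Real.exp (K * x) := by
  rcases hK.eq_or_lt with rfl | hK
  · simp [gronwallBound_K0]
  · rw [gronwallBound_of_K_ne_0 hK.ne']
    have h : Real.exp (K * x) - 1 ≤ K * x * Real.exp (K * x) := by
      have h₁ := mul_le_mul_of_nonneg_right (Real.add_one_le_exp (-(K * x)))
        (Real.exp_pos (K * x)).le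
      rw [← Real.exp_add, neg_add_cancel, Real.exp_zero] at h₁
      linarith
    calc 0 * Real.exp (K * x) + ε / K * (Real.exp (K * x) - 1)
        ≤ 0 * Real.exp (K * x) + ε / K * (K * x * Real.exp (K * x)) := by gcongr
      _ = ε * x * Real.exp (K * x) := by field_simp; ring

/-- key estimate in the proof of the paper's Theorem 3:
`|ρ φ − ρ φᵈ| ≤ L_ρ M b e^{L_f b}` for `‖d‖ ≤ M`, combining the trajectory
divergence bound of Lemma 2 with the partial Lipschitz property of `ρ`. -/
theorem robustness_difference_bound
    {n : ℕ} (b L_f L_ρ M : ℝ) (hb : 0 < b) (hLf : 0 ≤ L_f) (hLρ : 0 ≤ L_ρ)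
    (hM : 0 ≤ M)
    (f_cl : EuclideanSpace ℝ (Fin n) → EuclideanSpace ℝ (Fin n))
    (hf_lip : ∀ x y : EuclideanSpace ℝ (Fin n), ‖f_cl x - f_cl y‖ ≤ L_f * ‖x - y‖)
    (ρ : (ℝ → EuclideanSpace ℝ (Fin n)) → ℝ)
    (hρ_lip : ∀ s z : ℝ → EuclideanSpace ℝ (Fin n),
      ContinuousOn s (Set.Icc (0 : ℝ) b) → ContinuousOn z (Set.Icc (0 : ℝ) b) →
      |ρ s - ρ z| ≤ L_ρ * sSup ((fun t => ‖s t - z t‖) '' Set.Icc (0 : ℝ) b))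
    (d : EuclideanSpace ℝ (Fin n)) (hd : ‖d‖ ≤ M)
    (φ φd : ℝ → EuclideanSpace ℝ (Fin n))
    (hφ : ∀ t ∈ Set.Icc (0 : ℝ) b, HasDerivAt φ (f_cl (φ t)) t)
    (hφd : ∀ t ∈ Set.Icc (0 : ℝ) b, HasDerivAt φd (f_cl (φd t) + d) t)
    (h0 : φ 0 = φd 0) :
    |ρ φ - ρ φd| ≤ L_ρ * M * b * Real.exp (L_f * b) := by
  have hφc : ContinuousOn φ (Set.Icc 0 b) := HasDerivAt.continuousOn hφ
  have hφdc : ContinuousOn φd (Set.Icc 0 b) := HasDerivAt.continuousOn hφd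
  have hgronwall : ∀ t ∈ Set.Icc (0 : ℝ) b,
      ‖φ t - φd t‖ ≤ gronwallBound 0 L_f M (t - 0) := by
    refine norm_le_gronwallBound_of_norm_deriv_right_le (hφc.fun_sub hφdc)
      (fun t ht => ((hφ t (Set.Ico_subset_Icc_self ht)).sub
        (hφd t (Set.Ico_subset_Icc_self ht))).hasDerivWithinAt) (by simp [h0]) fun t _ => ?_
    rw [← sub_sub]
    exact (norm_sub_le _ _).trans (add_le_add (hf_lip _ _) hd)
  have hsup : sSup ((fun t => ‖φ t - φd t‖) '' Set.Icc (0 : ℝ) b) ≤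
      M * b * Real.exp (L_f * b) := by
    refine csSup_le ((Set.nonempty_Icc.2 hb.le).image _) ?_
    rintro _ ⟨t, ht, rfl⟩
    calc ‖φ t - φd t‖ ≤ gronwallBound 0 L_f M (t - 0) := hgronwall t ht
      _ ≤ gronwallBound 0 L_f M b :=
        gronwallBound_mono le_rfl hM hLf (by simpa using ht.2)
      _ ≤ M * b * Real.exp (L_f * b) := gronwallBound_zero_le_mul_exp hLf hM b
  calc |ρ φ - ρ φd|
      ≤ L_ρ * sSup ((fun t => ‖φ t - φd t‖) '' Set.Icc (0 : ℝ) b) := hρ_lip φ φd hφc hφdc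
    _ ≤ L_ρ * (M * b * Real.exp (L_f * b)) := mul_le_mul_of_nonneg_left hsup hLρ
    _ = L_ρ * M * b * Real.exp (L_f * b) := by ring
end
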